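/- arXiv:1204.2975 — 2 statements merged into one kernel-verified Lean document; each statement's English description precedes it below -/
import Mathlib

section
/- Let G_l, G_m be fully supported distributions on a finite set X and E > 0. If for some N there exists a type Q ∈ Q^N(X) with D(Q‖G_l) ≤ E, then G_m^N(B_l^N) ≥ (N+1)^{-|X|} · exp(-N · min{ D(Q‖G_m) : Q ∈ Q^N(X), D(Q‖G_l) ≤ E }), where B_l^N = { x : D(Q_x‖G_l) ≤ E }. -/
/-- The empirical distribution (type) of a sequence `x : Fin N → X`. -/
noncomputable def empDist {X : Type*} [Fintype X] [DecidableEq X] {N : ℕ}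
    (x : Fin N → X) : X → ℝ :=
  fun a => ((Finset.univ.filter (fun n => x n = a)).card : ℝ) / N

/-- Kullback–Leibler divergence of `Q` from `G` on a finite set. -/
noncomputable def dKL {X : Type*} [Fintype X] (Q G : X → ℝ) : ℝ :=
  ∑ a, Q a * Real.log (Q a / G a)

/-- `G` is a probability distribution on a finite set. -/
def IsProb {X : Type*} [Fintype X] (G : X → ℝ) : Prop :=
  (∀ a, 0 ≤ G a) ∧ ∑ a, G a = 1

theorem fact_le_aux (k j : ℕ) (h : j ≤ k) : k.factorial ≤ j.factorial * k ^ (k - j) := by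
  have h1 := Nat.factorial_mul_descFactorial (Nat.sub_le k j)
  rw [Nat.sub_sub_self h] at h1
  rw [← h1]
  exact Nat.mul_le_mul_left _ (Nat.descFactorial_le_pow _ _)

/-- Number of occurrences of `a` in `x`. -/
def occ {X : Type*} [DecidableEq X] {N : ℕ} (x : Fin N → X) (a : X) : ℕ :=
  (Finset.univ.filter (fun n => x n = a)).card

theorem occ_sum {X : Type*} [Fintype X] [DecidableEq X] {N : ℕ} (x : Fin N → X) :
    ∑ a, occ x a = N := by
  unfold occ
  rw [← Finset.card_eq_sum_card_fiberwise (f := x) (s := Finset.univ) (t := Finset.univ)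
    (fun _ _ => by simp)]
  simp

theorem occ_prod {X : Type*} [Fintype X] [DecidableEq X] {N : ℕ} (x : Fin N → X) (f : X → ℝ) :
    ∏ n, f (x n) = ∏ a, f a ^ occ x a := by
  unfold occ
  rw [← Finset.prod_fiberwise' Finset.univ x f]
  simp [Finset.prod_const]

theorem fact_pow_le (k j : ℕ) : k.factorial * k ^ j ≤ j.factorial * k ^ k := by
  rcases le_total k j with h | h
  · have h1 := Nat.factorial_mul_pow_sub_le_factorial h
    calc k.factorial * k ^ j = (k.factorial * k ^ (j - k)) * k ^ k := by
          rw [mul_assoc, ← pow_add, Nat.sub_add_cancel h]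
      _ ≤ _ := Nat.mul_le_mul_right _ h1
  · have h1 := fact_le_aux k j h
    calc k.factorial * k ^ j ≤ (j.factorial * k ^ (k - j)) * k ^ j := Nat.mul_le_mul_right _ h1
      _ = _ := by rw [mul_assoc, ← pow_add, Nat.sub_add_cancel h]

theorem multinomial_le_card {X : Type*} [Fintype X] [DecidableEq X] {N : ℕ} (x : Fin N → X) :
    Nat.multinomial Finset.univ (occ x) ≤
      (Finset.univ.filter (fun y : Fin N → X => occ y = occ x)).card := by
  have hpos : 0 < ∏ a, (occ x a).factorial := Finset.prod_pos fun a _ => Nat.factorial_pos _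
  refine Nat.le_of_mul_le_mul_left ?_ hpos
  rw [Nat.multinomial_spec, occ_sum]
  have h := Finset.card_le_mul_card_image_of_maps_to
    (s := (Finset.univ : Finset (Equiv.Perm (Fin N))))
    (t := Finset.univ.filter (fun y : Fin N → X => occ y = occ x))
    (f := fun σ : Equiv.Perm (Fin N) => x ∘ σ) (fun σ _ => ?_) (∏ a, (occ x a).factorial) (fun y _ => ?_)
  · simpa [Fintype.card_perm] using h
  · simp only [Finset.mem_filter, Finset.mem_univ, true_and]
    funext a
    unfold occ
    refine Finset.card_bij (fun n _ => σ n) ?_ ?_ ?_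
    · intro n hn; simpa using hn
    · intro n _ m _ h; exact σ.injective h
    · intro n hn; exact ⟨σ.symm n, by simpa using hn, by simp⟩
  · have hst := DomMulAct.stabilizer_card x
    have hst' : (Finset.univ.filter (fun σ : Equiv.Perm (Fin N) => x ∘ σ = x)).card
        = ∏ a, (occ x a).factorial := by
      rw [← Fintype.card_subtype, hst]
      refine Finset.prod_congr rfl fun a _ => ?_
      rw [Fintype.card_subtype]; rfl
    rw [← hst']
    rcases (Finset.univ.filter (fun σ : Equiv.Perm (Fin N) => x ∘ σ = y)).eq_empty_or_nonempty
      with h0 | ⟨τ, hτ⟩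
    · rw [h0]; simp
    · have hτ' : x ∘ τ = y := by simpa using hτ
      refine Finset.card_le_card_of_injOn (fun σ : Equiv.Perm (Fin N) => σ * τ⁻¹) ?_ ?_
      · intro σ hσ
        have hσ' : x ∘ σ = y := by simpa using hσ
        have : x ∘ (σ * τ⁻¹ : Equiv.Perm (Fin N)) = x := by
          funext n
          have h1 := congrFun (hσ'.trans hτ'.symm) (τ⁻¹ n)
          simpa using h1
        simpa using this
      · intro σ _ ρ _ h
        exact mul_right_cancel h

theorem types_bound {X : Type*} [Fintype X] [DecidableEq X] {N : ℕ} (x : Fin N → X) :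
    N ^ N ≤ (N + 1) ^ Fintype.card X *
      ((Finset.univ.filter (fun y : Fin N → X => occ y = occ x)).card *
        ∏ a, occ x a ^ occ x a) := by
  have h1 := Finset.sum_pow_eq_sum_piAntidiag (Finset.univ : Finset X) (occ x) N
  rw [occ_sum] at h1
  simp only [Nat.cast_id] at h1
  rw [h1]
  have hcard : (Finset.piAntidiag (Finset.univ : Finset X) N).card ≤ (N + 1) ^ Fintype.card X := by
    have : Finset.piAntidiag (Finset.univ : Finset X) N ⊆
        Fintype.piFinset (fun _ : X => Finset.range (N + 1)) := by
      intro f hf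
      rw [Finset.mem_piAntidiag] at hf
      rw [Fintype.mem_piFinset]
      intro a
      rw [Finset.mem_range]
      have := Finset.single_le_sum (f := f) (fun i _ => Nat.zero_le _) (Finset.mem_univ a)
      exact Nat.lt_succ_of_le (this.trans hf.1.le)
    refine (Finset.card_le_card this).trans ?_
    simp
  refine (Finset.sum_le_card_nsmul _ _
    ((Finset.univ.filter (fun y : Fin N → X => occ y = occ x)).card *
        ∏ a, occ x a ^ occ x a) ?_).trans ?_
  · intro j hj
    rw [Finset.mem_piAntidiag] at hj
    refine le_trans ?_ (Nat.mul_le_mul_right _ (multinomial_le_card x))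
    have hA : 0 < ∏ a, (occ x a).factorial := Finset.prod_pos fun a _ => Nat.factorial_pos _
    have hB : 0 < ∏ a, (j a).factorial := Finset.prod_pos fun a _ => Nat.factorial_pos _
    have e1 := Nat.multinomial_spec Finset.univ (occ x)
    have e2 := Nat.multinomial_spec Finset.univ j
    rw [occ_sum] at e1
    rw [hj.1] at e2
    have e3 : (∏ a, (occ x a).factorial) * ∏ a, occ x a ^ j a ≤
        (∏ a, (j a).factorial) * ∏ a, occ x a ^ occ x a := by
      rw [← Finset.prod_mul_distrib, ← Finset.prod_mul_distrib]
      exact Finset.prod_le_prod' fun a _ => fact_pow_le _ _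
    refine Nat.le_of_mul_le_mul_left ?_ (Nat.mul_pos hA hB)
    calc _ = ((∏ a, (j a).factorial) * Nat.multinomial Finset.univ j) *
          ((∏ a, (occ x a).factorial) * ∏ a, occ x a ^ j a) := by ring
      _ ≤ ((∏ a, (j a).factorial) * Nat.multinomial Finset.univ j) *
          ((∏ a, (j a).factorial) * ∏ a, occ x a ^ occ x a) := Nat.mul_le_mul_left _ e3
      _ = ((∏ a, (occ x a).factorial) * Nat.multinomial Finset.univ (occ x)) *
          ((∏ a, (j a).factorial) * ∏ a, occ x a ^ occ x a) := by rw [e1, e2]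
      _ = _ := by ring
  · rw [smul_eq_mul]
    exact Nat.mul_le_mul_right _ hcard

theorem exp_dKL_mul {X : Type*} [Fintype X] [DecidableEq X] {N : ℕ} (hN : 0 < N)
    (x : Fin N → X) (G : X → ℝ) (hG : ∀ a, 0 < G a) :
    Real.exp (-(N * dKL (empDist x) G)) * ∏ a, (occ x a : ℝ) ^ occ x a =
      (N : ℝ) ^ N * ∏ a, G a ^ occ x a := by
  have hN' : (0 : ℝ) < N := by exact_mod_cast hN
  have e : (N : ℝ) ^ N = ∏ a, (N : ℝ) ^ occ x a := by
    rw [Finset.prod_pow_eq_pow_sum, occ_sum]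
  rw [e, ← Finset.prod_mul_distrib]
  unfold dKL
  rw [Finset.mul_sum, ← Finset.sum_neg_distrib, Real.exp_sum, ← Finset.prod_mul_distrib]
  refine Finset.prod_congr rfl fun a _ => ?_
  have hq : empDist x a = (occ x a : ℝ) / N := rfl
  rw [hq]
  rcases Nat.eq_zero_or_pos (occ x a) with h0 | h0
  · simp [h0]
  · have hk : (0 : ℝ) < occ x a := by exact_mod_cast h0
    have hg := hG a
    have : -((N : ℝ) * ((occ x a : ℝ) / N * Real.log ((occ x a : ℝ) / N / G a))) =
        (occ x a : ℕ) * Real.log (N * G a / occ x a) := by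
      have : (N : ℝ) * G a / occ x a = ((occ x a : ℝ) / N / G a)⁻¹ := by field_simp
      rw [this, Real.log_inv]
      field_simp
    rw [this, Real.exp_nat_mul, Real.exp_log (by positivity), ← mul_pow, ← mul_pow]
    congr 1
    field_simp

/-- Lower bound on the probability under `G_m^N` of the acceptance region
`B_l^N = {x : D(Q_x‖G_l) ≤ E}`, in terms of the minimal divergence from `G_m`
over types in the divergence ball around `G_l`. -/
theorem acceptance_prob_lower (X : Type*) [Fintype X] [DecidableEq X]
    (N : ℕ) (hN : 0 < N)
    (Gl Gm : X → ℝ) (hGl : IsProb Gl) (hGlpos : ∀ a, 0 < Gl a)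
    (hGm : IsProb Gm) (hGmpos : ∀ a, 0 < Gm a) (E : ℝ) (hE : 0 < E)
    (hball : ∃ x : Fin N → X, dKL (empDist x) Gl ≤ E) :
    (((N : ℝ) + 1) ^ Fintype.card X)⁻¹ *
        Real.exp (-(N * sInf {d : ℝ | ∃ x : Fin N → X,
          dKL (empDist x) Gl ≤ E ∧ d = dKL (empDist x) Gm}))
      ≤ ∑ x ∈ Finset.univ.filter (fun x : Fin N → X => dKL (empDist x) Gl ≤ E),
          ∏ n, Gm (x n) := by
  set S : Set ℝ := {d : ℝ | ∃ x : Fin N → X,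
          dKL (empDist x) Gl ≤ E ∧ d = dKL (empDist x) Gm} with hS
  have hfin : S.Finite := by
    refine (Set.finite_range (fun x : Fin N → X => dKL (empDist x) Gm)).subset ?_
    rintro d ⟨x, _, rfl⟩
    exact ⟨x, rfl⟩
  have hne : S.Nonempty := by
    obtain ⟨x, hx⟩ := hball
    exact ⟨_, x, hx, rfl⟩
  obtain ⟨x, hx, hxe⟩ := hne.csInf_mem hfin
  rw [hxe]
  set T := Finset.univ.filter (fun y : Fin N → X => occ y = occ x) with hT
  have hsub : T ⊆ Finset.univ.filter (fun x : Fin N → X => dKL (empDist x) Gl ≤ E) := by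
    intro y hy
    simp only [hT, Finset.mem_filter, Finset.mem_univ, true_and] at hy ⊢
    have : empDist y = empDist x := by
      funext a
      have h := congrFun hy a
      unfold occ at h
      unfold empDist
      rw [h]
    rw [this]; exact hx
  refine le_trans ?_ (Finset.sum_le_sum_of_subset_of_nonneg hsub
    fun y _ _ => Finset.prod_nonneg fun n _ => (hGmpos _).le)
  have hsum : ∑ y ∈ T, ∏ n, Gm (y n) = T.card * ∏ a, Gm a ^ occ x a := by
    rw [← nsmul_eq_mul, ← Finset.sum_const]
    refine Finset.sum_congr rfl fun y hy => ?_
    rw [occ_prod, (Finset.mem_filter.1 hy).2]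
  rw [hsum, inv_mul_le_iff₀ (by positivity)]
  have hkpos : 0 < ∏ a, (occ x a : ℝ) ^ occ x a := by
    refine Finset.prod_pos fun a _ => ?_
    rcases Nat.eq_zero_or_pos (occ x a) with h0 | h0
    · simp [h0]
    · have : (0 : ℝ) < occ x a := by exact_mod_cast h0
      positivity
  refine le_of_mul_le_mul_right ?_ hkpos
  rw [exp_dKL_mul hN x Gm hGmpos]
  have hb : (N : ℝ) ^ N ≤ ((N : ℝ) + 1) ^ Fintype.card X *
      (T.card * ∏ a, (occ x a : ℝ) ^ occ x a) := by
    exact_mod_cast types_bound x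
  have hgp : 0 ≤ ∏ a, Gm a ^ occ x a :=
    Finset.prod_nonneg fun a _ => pow_nonneg (hGmpos a).le _
  calc _ ≤ (((N : ℝ) + 1) ^ Fintype.card X *
      (T.card * ∏ a, (occ x a : ℝ) ^ occ x a)) * ∏ a, Gm a ^ occ x a :=
        mul_le_mul_of_nonneg_right hb hgp
    _ = _ := by ring
end

section
/- (Stein-type identification exponent) Let G_1,...,G_M be distinct fully supported distributions on a finite set X, and fix r and E_{r|r} > 0 satisfying E_{r|r} < min_{m ≠ r} D(G_m‖G_r). For the test that identifies hypothesis r iff the sample type Q satisfies D(Q‖G_r) ≤ E_{r|r}, the exponent of the false-identification probability max_{m ≠ r} G_m^N({x : D(Q_x‖G_r) ≤ E_{r|r}}) equals min_{m ≠ r} inf{ D(Q‖G_m) : D(Q‖G_r) ≤ E_{r|r} }, in the sense that the probability is bounded above by (N+1)^{|X|} exp(-N·(that exponent)) and, for all N with a type in the ball, below by (N+1)^{-|X|} exp(-N·(the discrete version of the exponent)). -/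
namespace IdentExp

open Finset

/-- Occurrence counts of a sequence. -/
def cnt {X : Type*} [DecidableEq X] {N : ℕ} (x : Fin N → X) (a : X) : ℕ :=
  (Finset.univ.filter (fun n => x n = a)).card

variable {X : Type*} [Fintype X] [DecidableEq X] {N : ℕ}

lemma empDist_eq (x : Fin N → X) (a : X) : empDist x a = (cnt x a : ℝ) / N := rfl

lemma empDist_congr {x y : Fin N → X} (h : cnt y = cnt x) : empDist y = empDist x := by
  funext a; rw [empDist_eq, empDist_eq, h]

lemma cnt_le (x : Fin N → X) (a : X) : cnt x a ≤ N := by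
  have := Finset.card_filter_le (Finset.univ : Finset (Fin N)) (fun n => x n = a)
  simpa [cnt] using this

lemma sum_cnt (x : Fin N → X) : ∑ a, cnt x a = N := by
  have := Finset.card_eq_sum_card_fiberwise (s := (Finset.univ : Finset (Fin N)))
    (t := (Finset.univ : Finset X)) (f := x) (by simp)
  simpa [cnt] using this.symm

lemma prod_eq {R : Type*} [CommMonoid R] (g : X → R) (x : Fin N → X) :
    ∏ n, g (x n) = ∏ a, g a ^ cnt x a := by
  rw [← Finset.prod_fiberwise (s := Finset.univ) (g := x) (f := fun n => g (x n))]
  refine Finset.prod_congr rfl fun a _ => ?_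
  rw [cnt, ← Finset.prod_const]
  refine Finset.prod_congr rfl fun n hn => ?_
  simp at hn; rw [hn]

lemma cnt_pos (x : Fin N → X) (n : Fin N) : 0 < cnt x (x n) :=
  Finset.card_pos.mpr ⟨n, by simp⟩

lemma isProb_empDist (hN : 0 < N) (x : Fin N → X) : IsProb (empDist x) := by
  refine ⟨fun a => by rw [empDist_eq]; positivity, ?_⟩
  simp_rw [empDist_eq]
  rw [← Finset.sum_div, ← Nat.cast_sum, sum_cnt]
  have : (N : ℝ) ≠ 0 := by positivity
  exact div_self this

lemma tilt (hN : 0 < N) (x : Fin N → X) (G : X → ℝ) (hG : ∀ a, 0 < G a) :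
    ∏ n, G (x n) = Real.exp (-(N * dKL (empDist x) G)) * ∏ n, empDist x (x n) := by
  have hN' : (N : ℝ) ≠ 0 := by positivity
  have h1 : Real.exp (-(N * dKL (empDist x) G))
      = ∏ n, (G (x n) / empDist x (x n)) := by
    rw [prod_eq (fun a => G a / empDist x a) x, dKL, Finset.mul_sum, ← Finset.sum_neg_distrib,
      Real.exp_sum]
    refine Finset.prod_congr rfl fun a _ => ?_
    rcases Nat.eq_zero_or_pos (cnt x a) with h | h
    · simp [empDist_eq, h]
    · have hq : 0 < empDist x a := by rw [empDist_eq]; positivity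
      have : -((N : ℝ) * (empDist x a * Real.log (empDist x a / G a)))
          = cnt x a * Real.log (G a / empDist x a) := by
        rw [← inv_div (empDist x a) (G a), Real.log_inv]
        have : (N : ℝ) * empDist x a = cnt x a := by
          rw [empDist_eq]; field_simp
        rw [← this]; ring
      rw [this, Real.exp_nat_mul, Real.exp_log (div_pos (hG a) hq)]
  rw [h1, ← Finset.prod_mul_distrib]
  refine Finset.prod_congr rfl fun n _ => ?_
  have hq : 0 < empDist x (x n) := by
    have := cnt_pos x n
    rw [empDist_eq]; positivity
  field_simp

lemma dKL_nonneg (Q G : X → ℝ) (hQ : IsProb Q) (hG : IsProb G) (hG' : ∀ a, 0 < G a) :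
    0 ≤ dKL Q G := by
  have : ∑ a, (Q a - G a) ≤ dKL Q G := by
    refine Finset.sum_le_sum fun a _ => ?_
    rcases (hQ.1 a).eq_or_lt with h | h
    · rw [← h]; simpa using (hG' a).le
    · have h2 := Real.log_le_sub_one_of_pos (div_pos (hG' a) h)
      rw [← inv_div (Q a) (G a), Real.log_inv, inv_div] at h2
      have h3 := mul_le_mul_of_nonneg_left h2 h.le
      have h4 : Q a * (G a / Q a - 1) = G a - Q a := by field_simp
      linarith
  rw [Finset.sum_sub_distrib, hQ.2, hG.2] at this
  linarith

lemma sum_all (Q : X → ℝ) (hQ : IsProb Q) : ∑ x : Fin N → X, ∏ n, Q (x n) = 1 := by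
  have := Fintype.sum_pow Q N
  rw [← this, hQ.2, one_pow]

/-- Summation over type classes. -/
lemma sum_types (S : Finset (Fin N → X)) (f : (Fin N → X) → ℝ) (B : ℝ) (hB : 0 ≤ B)
    (h : ∀ x ∈ S, ∑ y ∈ S.filter (fun y => cnt y = cnt x), f y ≤ B) :
    ∑ y ∈ S, f y ≤ ((N : ℝ) + 1) ^ Fintype.card X * B := by
  let t : (Fin N → X) → (X → Fin (N + 1)) := fun y a => ⟨cnt y a, Nat.lt_succ_of_le (cnt_le y a)⟩
  have ht : ∀ x y, t y = t x ↔ cnt y = cnt x := by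
    intro x y
    simp [t, funext_iff]
  rw [← Finset.sum_fiberwise (s := S) (g := t)]
  have hb : ∀ k ∈ (Finset.univ : Finset (X → Fin (N + 1))), ∑ y ∈ S with t y = k, f y ≤ B := by
    intro k _
    rcases (S.filter (fun y => t y = k)).eq_empty_or_nonempty with he | ⟨x, hx⟩
    · rw [he]; simpa using hB
    · rw [Finset.mem_filter] at hx
      have := h x hx.1
      simp_rw [← ht] at this
      rwa [hx.2] at this
  refine (Finset.sum_le_card_nsmul _ _ _ hb).trans (le_of_eq ?_)
  simp

lemma cnt_comp (x : Fin N → X) (σ : Equiv.Perm (Fin N)) : cnt (x ∘ σ) = cnt x := by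
  funext a
  unfold cnt
  refine Finset.card_bij (fun n _ => σ n) ?_ ?_ ?_
  · intro n hn; simpa using hn
  · intro n _ m _ h; exact σ.injective h
  · intro m hm
    exact ⟨σ.symm m, by simpa using hm, by simp⟩

lemma exists_perm {x y : Fin N → X} (h : cnt y = cnt x) :
    ∃ σ : Equiv.Perm (Fin N), x ∘ σ = y := by
  have e : ∀ a, Nonempty ({n // y n = a} ≃ {n // x n = a}) := fun a => by
    refine ⟨Fintype.equivOfCardEq ?_⟩
    rw [Fintype.card_subtype, Fintype.card_subtype]
    exact congrFun h a
  refine ⟨(Equiv.sigmaFiberEquiv y).symm.trans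
    ((Equiv.sigmaCongrRight fun a => (e a).some).trans (Equiv.sigmaFiberEquiv x)), ?_⟩
  funext n
  exact ((e (y n)).some ⟨n, rfl⟩).2

lemma card_class (x : Fin N → X) :
    (univ.filter (fun y : Fin N → X => cnt y = cnt x)).card * ∏ a, (cnt x a).factorial
      = N.factorial := by
  have hs := DomMulAct.stabilizer_card x
  have h := Finset.card_eq_sum_card_fiberwise (s := (univ : Finset (Equiv.Perm (Fin N))))
    (t := univ.filter (fun y : Fin N → X => cnt y = cnt x)) (f := fun σ : Equiv.Perm (Fin N) => x ∘ σ)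
    (fun σ _ => by simp [cnt_comp])
  rw [Finset.card_univ, Fintype.card_perm, Fintype.card_fin] at h
  rw [h, Finset.sum_const_nat (m := ∏ a, (cnt x a).factorial)]
  intro y hy
  simp only [Finset.mem_filter, Finset.mem_univ, true_and] at hy
  obtain ⟨τ, rfl⟩ := exists_perm hy
  have h1 : ∏ a, (cnt x a).factorial = Fintype.card {g : Equiv.Perm (Fin N) // x ∘ g = x} := by
    rw [hs]
    refine Finset.prod_congr rfl fun a _ => ?_
    rw [Fintype.card_subtype]; rfl
  rw [h1, Fintype.card_subtype]
  refine Finset.card_bij (fun σ _ => σ * τ⁻¹) ?_ ?_ ?_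
  · intro σ hσ
    simp only [Finset.mem_filter, Finset.mem_univ, true_and] at hσ ⊢
    funext n
    have := congrFun hσ (τ⁻¹ n)
    simpa using this
  · intro σ _ ρ _ h; exact mul_right_cancel h
  · intro σ hσ
    simp only [Finset.mem_filter, Finset.mem_univ, true_and] at hσ
    refine ⟨σ * τ, ?_, by simp⟩
    simp only [Finset.mem_filter, Finset.mem_univ, true_and]
    funext n
    exact congrFun hσ (τ n)

lemma fact_ineq (c k : ℕ) : c.factorial * c ^ k ≤ k.factorial * c ^ c := by
  rcases le_total c k with h | h
  · have := Nat.factorial_mul_pow_sub_le_factorial h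
    calc c.factorial * c ^ k = (c.factorial * c ^ (k - c)) * c ^ c := by
          rw [mul_assoc, ← pow_add, Nat.sub_add_cancel h]
      _ ≤ _ := Nat.mul_le_mul_right _ this
  · have : c.factorial ≤ k.factorial * c ^ (c - k) := by
      have := Nat.factorial_mul_descFactorial (Nat.sub_le c k)
      have h2 := Nat.descFactorial_le_pow c (c - k)
      rw [Nat.sub_sub_self h] at this
      rw [← this]
      exact Nat.mul_le_mul_left _ h2
    calc c.factorial * c ^ k ≤ (k.factorial * c ^ (c - k)) * c ^ k := Nat.mul_le_mul_right _ this
      _ = _ := by rw [mul_assoc, ← pow_add, Nat.sub_add_cancel h]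

lemma class_sum (x y : Fin N → X) :
    ∑ z ∈ univ.filter (fun z : Fin N → X => cnt z = cnt y), ∏ n, empDist x (z n)
      = ((univ.filter (fun z : Fin N → X => cnt z = cnt y)).card : ℝ)
        * (∏ a, (cnt x a : ℝ) ^ cnt y a) / (N : ℝ) ^ N := by
  rw [Finset.sum_congr rfl (g := fun _ => (∏ a, (cnt x a : ℝ) ^ cnt y a) / (N : ℝ) ^ N)]
  · rw [Finset.sum_const, nsmul_eq_mul, mul_div_assoc]
  · intro z hz
    simp only [Finset.mem_filter, Finset.mem_univ, true_and] at hz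
    rw [prod_eq, hz]
    simp_rw [empDist_eq, div_pow]
    rw [Finset.prod_div_distrib, Finset.prod_pow_eq_pow_sum, sum_cnt]

lemma class_le (x y : Fin N → X) :
    ∑ z ∈ univ.filter (fun z : Fin N → X => cnt z = cnt y), ∏ n, empDist x (z n)
      ≤ ∑ z ∈ univ.filter (fun z : Fin N → X => cnt z = cnt x), ∏ n, empDist x (z n) := by
  rw [class_sum, class_sum]
  refine div_le_div_of_nonneg_right ?_ (by positivity)
  have hx := card_class x
  have hy := card_class y
  set A := (univ.filter (fun z : Fin N → X => cnt z = cnt x)).card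
  set B := (univ.filter (fun z : Fin N → X => cnt z = cnt y)).card
  have key : B * ∏ a, cnt x a ^ cnt y a ≤ A * ∏ a, cnt x a ^ cnt x a := by
    have hp : (∏ a, (cnt x a).factorial) * ∏ a, cnt x a ^ cnt y a
        ≤ (∏ a, (cnt y a).factorial) * ∏ a, cnt x a ^ cnt x a := by
      rw [← Finset.prod_mul_distrib, ← Finset.prod_mul_distrib]
      exact Finset.prod_le_prod' fun a _ => fact_ineq _ _
    have p1 : 0 < ∏ a, (cnt x a).factorial := Finset.prod_pos fun a _ => Nat.factorial_pos _
    have p2 : 0 < ∏ a, (cnt y a).factorial := Finset.prod_pos fun a _ => Nat.factorial_pos _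
    refine Nat.le_of_mul_le_mul_left ?_ (Nat.mul_pos p1 p2)
    have := Nat.mul_le_mul_left N.factorial hp
    calc _ = (B * ∏ a, (cnt y a).factorial) *
          ((∏ a, (cnt x a).factorial) * ∏ a, cnt x a ^ cnt y a) := by ring
      _ ≤ (A * ∏ a, (cnt x a).factorial) *
          ((∏ a, (cnt y a).factorial) * ∏ a, cnt x a ^ cnt x a) := by rw [hx, hy]; exact this
      _ = _ := by ring
  exact_mod_cast key

lemma class_lower (hN : 0 < N) (x : Fin N → X) :
    (((N : ℝ) + 1) ^ Fintype.card X)⁻¹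
      ≤ ∑ z ∈ univ.filter (fun z : Fin N → X => cnt z = cnt x), ∏ n, empDist x (z n) := by
  have hp := isProb_empDist hN x
  have h := sum_types (univ : Finset (Fin N → X)) (fun z => ∏ n, empDist x (z n))
    (∑ z ∈ univ.filter (fun z : Fin N → X => cnt z = cnt x), ∏ n, empDist x (z n))
    (Finset.sum_nonneg fun z _ => Finset.prod_nonneg fun n _ => hp.1 _)
    (fun y _ => class_le x y)
  rw [sum_all _ hp] at h
  rw [inv_le_iff_one_le_mul₀' (by positivity)]
  exact h

lemma class_tilt (hN : 0 < N) (x : Fin N → X) (G : X → ℝ) (hG : ∀ a, 0 < G a) :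
    ∑ z ∈ univ.filter (fun z : Fin N → X => cnt z = cnt x), ∏ n, G (z n)
      = Real.exp (-(N * dKL (empDist x) G)) *
        ∑ z ∈ univ.filter (fun z : Fin N → X => cnt z = cnt x), ∏ n, empDist x (z n) := by
  rw [Finset.mul_sum]
  refine Finset.sum_congr rfl fun z hz => ?_
  simp only [Finset.mem_filter, Finset.mem_univ, true_and] at hz
  rw [tilt hN z G hG, empDist_congr hz]

end IdentExp

/-- Stein-type identification exponent (Theorem 5.1): for the test that
identifies hypothesis `r` iff the sample type lies in the divergence ball
`{Q : D(Q‖G_r) ≤ E}`, the false-identification probability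
`max_{m ≠ r} G_m^N(ball)` is bounded above by
`(N+1)^{|X|} exp(-N · min_{m ≠ r} inf{D(Q‖G_m) : D(Q‖G_r) ≤ E})` and
(whenever some type lies in the ball) below by
`(N+1)^{-|X|} exp(-N ·` the discrete version of that exponent `)`. -/
theorem identification_exponent (X : Type*) [Fintype X] [DecidableEq X]
    (M : ℕ) (hM : 2 ≤ M) (G : Fin M → X → ℝ)
    (hG : ∀ m, IsProb (G m) ∧ ∀ a, 0 < G m a)
    (hdistinct : ∀ l m, l ≠ m → G l ≠ G m)
    (r : Fin M) (E : ℝ) (hE : 0 < E)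
    (hcomp : ∀ m, m ≠ r → E < dKL (G m) (G r))
    (N : ℕ) (hN : 0 < N) :
    (∀ m, m ≠ r →
      ∑ x ∈ Finset.univ.filter (fun x : Fin N → X => dKL (empDist x) (G r) ≤ E),
          ∏ n, G m (x n)
        ≤ ((N : ℝ) + 1) ^ Fintype.card X *
          Real.exp (-(N * sInf {d : ℝ | ∃ m' : Fin M, m' ≠ r ∧
            ∃ Q : X → ℝ, IsProb Q ∧ dKL Q (G r) ≤ E ∧ d = dKL Q (G m')}))) ∧
    ((∃ x : Fin N → X, dKL (empDist x) (G r) ≤ E) →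
      ∃ m, m ≠ r ∧
        (((N : ℝ) + 1) ^ Fintype.card X)⁻¹ *
            Real.exp (-(N * sInf {d : ℝ | ∃ m' : Fin M, m' ≠ r ∧
              ∃ x : Fin N → X, dKL (empDist x) (G r) ≤ E ∧ d = dKL (empDist x) (G m')}))
          ≤ ∑ x ∈ Finset.univ.filter (fun x : Fin N → X => dKL (empDist x) (G r) ≤ E),
              ∏ n, G m (x n)) := by
  classical
  constructor
  · intro m hm
    refine IdentExp.sum_types _ _ _ (Real.exp_pos _).le ?_
    intro x hx
    simp only [Finset.mem_filter, Finset.mem_univ, true_and] at hx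
    have hp := IdentExp.isProb_empDist hN x
    calc _ ≤ ∑ z ∈ Finset.univ.filter (fun z : Fin N → X => IdentExp.cnt z = IdentExp.cnt x),
          ∏ n, G m (z n) := by
          refine Finset.sum_le_sum_of_subset_of_nonneg ?_ ?_
          · exact Finset.filter_subset_filter _ (Finset.subset_univ _)
          · intro z _ _
            exact Finset.prod_nonneg fun n _ => ((hG m).2 _).le
      _ ≤ Real.exp (-(N * dKL (empDist x) (G m))) * 1 := by
          rw [IdentExp.class_tilt hN x (G m) (hG m).2]
          refine mul_le_mul_of_nonneg_left ?_ (Real.exp_pos _).le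
          rw [← IdentExp.sum_all (N := N) _ hp]
          exact Finset.sum_le_sum_of_subset_of_nonneg (Finset.subset_univ _)
            fun z _ _ => Finset.prod_nonneg fun n _ => hp.1 _
      _ ≤ _ := by
          rw [mul_one]
          refine Real.exp_le_exp.mpr (neg_le_neg (mul_le_mul_of_nonneg_left ?_ (Nat.cast_nonneg _)))
          refine csInf_le ⟨0, ?_⟩ ⟨m, hm, _, hp, hx, rfl⟩
          rintro d ⟨m', -, Q, hQ, -, rfl⟩
          exact IdentExp.dKL_nonneg _ _ hQ (hG m').1 (hG m').2
  · rintro ⟨x₀, hx₀⟩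
    obtain ⟨m₀, hm₀⟩ : ∃ m : Fin M, m ≠ r := by
      have : Nontrivial (Fin M) := Fin.nontrivial_iff_two_le.mpr hM
      exact exists_ne r
    set S := {d : ℝ | ∃ m' : Fin M, m' ≠ r ∧
              ∃ x : Fin N → X, dKL (empDist x) (G r) ≤ E ∧ d = dKL (empDist x) (G m')} with hS
    have hfin : S.Finite := by
      refine (Set.finite_range
        (fun p : Fin M × (Fin N → X) => dKL (empDist p.2) (G p.1))).subset ?_
      rintro d ⟨m', -, x, -, rfl⟩
      exact ⟨(m', x), rfl⟩
    have hne : S.Nonempty := ⟨_, m₀, hm₀, x₀, hx₀, rfl⟩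
    obtain ⟨m, hm, x, hx, hd⟩ := hne.csInf_mem hfin
    refine ⟨m, hm, ?_⟩
    rw [hd]
    calc _ ≤ Real.exp (-(N * dKL (empDist x) (G m))) *
          ∑ z ∈ Finset.univ.filter (fun z : Fin N → X => IdentExp.cnt z = IdentExp.cnt x),
            ∏ n, empDist x (z n) := by
          rw [mul_comm]
          exact mul_le_mul_of_nonneg_left (IdentExp.class_lower hN x) (Real.exp_pos _).le
      _ = _ := (IdentExp.class_tilt hN x (G m) (hG m).2).symm
      _ ≤ _ := by
          refine Finset.sum_le_sum_of_subset_of_nonneg ?_ ?_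
          · intro z hz
            simp only [Finset.mem_filter, Finset.mem_univ, true_and] at hz ⊢
            rw [IdentExp.empDist_congr hz]; exact hx
          · intro z _ _
            exact Finset.prod_nonneg fun n _ => ((hG m).2 _).le
end
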